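/- Under the hypotheses of the generalized Gronwall inequality (u, v nonnegative integrable, g continuous nonnegative nondecreasing, ψ ∈ C¹ increasing with ψ' ≠ 0, α > 0, and u(t) ≤ v(t) + g(t)∫_a^t ψ'(τ)(ψ(t)−ψ(τ))^(α−1) u(τ)dτ), if in addition v is nondecreasing on [a,b], then u(t) ≤ v(t) · E_α(g(t) Γ(α) (ψ(t) − ψ(a))^α) for all t ∈ [a,b]. -/

import Mathlib

open MeasureTheory Real Set

/-- The one-parameter Mittag-Leffler function `E_α(z) = ∑ z^k / Γ(αk+1)`. -/
noncomputable def mittagLeffler (α z : ℝ) : ℝ :=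
  ∑' k : ℕ, z ^ k / Real.Gamma (α * k + 1)

open ProbabilityTheory in
lemma aux_key (a b : ℝ) (ψ : ℝ → ℝ) (hψc : ContinuousOn ψ (Set.Icc a b))
    (hmono : StrictMonoOn ψ (Set.Icc a b))
    (hψ' : ∀ x ∈ Set.Icc a b, deriv ψ x ≠ 0) (α β : ℝ) (hα : 0 < α) (hβ : 0 < β)
    (s t : ℝ) (hs : s ∈ Set.Icc a b) (ht : t ∈ Set.Icc a b) (hst : s < t) :
    ∫⁻ σ in Set.Ioo s t, ENNReal.ofReal |deriv ψ σ| *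
      ENNReal.ofReal ((ψ t - ψ σ) ^ (β - 1) * (ψ σ - ψ s) ^ (α - 1)) =
      ENNReal.ofReal (beta α β * (ψ t - ψ s) ^ (α + β - 1)) := by
  have hsub : Set.Icc s t ⊆ Set.Icc a b := Set.Icc_subset_Icc hs.1 ht.2
  have hL : 0 < ψ t - ψ s := sub_pos.2 (hmono hs ht hst)
  set l := ψ t - ψ s with hl
  let φ : ℝ → ℝ := fun x => (ψ x - ψ s) / l
  have hφm : StrictMonoOn φ (Set.Icc s t) := by
    intro x hx y hy hxy
    have := hmono (hsub hx) (hsub hy) hxy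
    simp only [φ]
    gcongr
  have hφc : ContinuousOn φ (Set.Icc s t) :=
    ((hψc.mono hsub).sub continuousOn_const).div_const _
  have him := hφc.image_Ioo_of_strictMonoOn hst.le hφm
  have h0 : φ s = 0 := by simp [φ]
  have h1 : φ t = 1 := by simp only [φ]; exact div_self hL.ne'
  rw [h0, h1] at him
  have hd : ∀ x ∈ Set.Ioo s t, HasDerivWithinAt φ (deriv ψ x / l) (Set.Ioo s t) x := by
    intro x hx
    have hx' := hψ' x (hsub (Set.Ioo_subset_Icc_self hx))
    have := (differentiableAt_of_deriv_ne_zero hx').hasDerivAt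
    exact ((this.sub_const _).div_const _).hasDerivWithinAt
  have hB := beta_pos hα hβ
  have h := lintegral_betaPDF_eq_one hα hβ
  rw [lintegral_betaPDF, ← him, lintegral_image_eq_lintegral_abs_deriv_mul measurableSet_Ioo hd
    (hφm.injOn.mono Set.Ioo_subset_Icc_self)] at h
  have : ∫⁻ σ in Set.Ioo s t, ENNReal.ofReal |deriv ψ σ| *
      ENNReal.ofReal ((ψ t - ψ σ) ^ (β - 1) * (ψ σ - ψ s) ^ (α - 1)) =
      ∫⁻ σ in Set.Ioo s t, ENNReal.ofReal (beta α β * l ^ (α + β - 1)) *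
       (ENNReal.ofReal |deriv ψ σ / l| *
        ENNReal.ofReal (1 / beta α β * φ σ ^ (α - 1) * (1 - φ σ) ^ (β - 1))) := by
    refine setLIntegral_congr_fun measurableSet_Ioo fun x hx => ?_
    have e1 : 0 < ψ x - ψ s := sub_pos.2 (hmono hs (hsub (Set.Ioo_subset_Icc_self hx)) hx.1)
    have e2 : 0 < ψ t - ψ x := sub_pos.2 (hmono (hsub (Set.Ioo_subset_Icc_self hx)) ht hx.2)
    have e3 : 1 - φ x = (ψ t - ψ x) / l := by
      simp only [φ]; field_simp; rw [hl]; ring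
    rw [← ENNReal.ofReal_mul (by positivity), ← ENNReal.ofReal_mul (by positivity),
      ← ENNReal.ofReal_mul (by positivity), e3]
    congr 1
    simp only [φ]
    rw [Real.div_rpow e1.le hL.le, Real.div_rpow e2.le hL.le, abs_div, abs_of_pos hL,
      show α + β - 1 = (α - 1) + (β - 1) + 1 by ring, Real.rpow_add hL, Real.rpow_add hL,
      Real.rpow_one]
    have p1 := Real.rpow_pos_of_pos hL (α - 1)
    have p2 := Real.rpow_pos_of_pos hL (β - 1)
    field_simp
  rw [this, lintegral_const_mul' _ _ ENNReal.ofReal_ne_top, h, mul_one]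

lemma aux_gamma (x R : ℝ) (hx : 0 ≤ x) (hR : 0 < R) :
    R ^ x * Real.exp (-R) ≤ Real.Gamma (x + 1) := by
  have hi := Real.GammaIntegral_convergent (s := x + 1) (by linarith)
  rw [Real.Gamma_eq_integral (by linarith), ← integral_exp_neg_Ioi, ← integral_const_mul]
  calc ∫ y in Set.Ioi R, R ^ x * Real.exp (-y)
      ≤ ∫ y in Set.Ioi R, Real.exp (-y) * y ^ (x + 1 - 1) := by
        refine setIntegral_mono_on ?_ (hi.mono_set (Set.Ioi_subset_Ioi hR.le)) measurableSet_Ioi ?_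
        · exact (integrableOn_exp_neg_Ioi R).const_mul _
        · intro y hy
          rw [mul_comm, add_sub_cancel_right]
          have : R ≤ y := le_of_lt hy
          gcongr
    _ ≤ _ := by
        refine setIntegral_mono_set hi ?_ (Set.Ioi_subset_Ioi hR.le).eventuallyLE
        refine (ae_restrict_iff' measurableSet_Ioi).2 (Filter.Eventually.of_forall fun y hy => ?_)
        have : 0 < y := hy
        simp only [Pi.zero_apply]
        positivity

lemma aux_summable (α z : ℝ) (hα : 0 < α) (hz : 0 ≤ z) :
    Summable fun k : ℕ => z ^ k / Real.Gamma (α * k + 1) := by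
  set R : ℝ := (2 * z + 1) ^ (1 / α) with hR
  have hRpos : 0 < R := by positivity
  have hRa : R ^ α = 2 * z + 1 := by
    rw [hR, ← Real.rpow_mul (by positivity), one_div_mul_cancel hα.ne', Real.rpow_one]
  refine Summable.of_nonneg_of_le (fun k => ?_) (fun k => ?_)
    (summable_geometric_two.mul_left (Real.exp R))
  · have := Real.Gamma_pos_of_pos (s := α * k + 1) (by positivity)
    positivity
  · have h := aux_gamma (α * k) R (by positivity) hRpos
    rw [Real.rpow_mul hRpos.le, hRa, Real.rpow_natCast] at h
    have hG := Real.Gamma_pos_of_pos (s := α * k + 1) (by positivity)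
    rw [div_le_iff₀ hG]
    calc z ^ k = Real.exp R * (1 / 2) ^ k * ((2 * z) ^ k * Real.exp (-R)) := by
          rw [mul_pow, Real.exp_neg]
          have : ((1:ℝ) / 2) ^ k * 2 ^ k = 1 := by rw [← mul_pow]; norm_num
          field_simp
          rw [mul_assoc, this, mul_one]
      _ ≤ Real.exp R * (1 / 2) ^ k * ((2 * z + 1) ^ k * Real.exp (-R)) := by
          gcongr; linarith
      _ ≤ _ := by gcongr

lemma aux_tendsto (α z : ℝ) (hα : 0 < α) (hz : 0 ≤ z) :
    Filter.Tendsto (fun n : ℕ => z ^ n / Real.Gamma (α * n)) Filter.atTop (nhds 0) := by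
  have h := (aux_summable α (2 * z) hα (by positivity)).tendsto_atTop_zero.const_mul α
  rw [mul_zero] at h
  refine squeeze_zero' ?_ ?_ h
  · filter_upwards [Filter.eventually_gt_atTop 0] with n hn
    have := Real.Gamma_pos_of_pos (s := α * n) (by positivity)
    positivity
  · filter_upwards [Filter.eventually_gt_atTop 0] with n hn
    have hG := Real.Gamma_pos_of_pos (s := α * n) (by positivity)
    have hn2 : (n : ℝ) ≤ 2 ^ n := by exact_mod_cast Nat.lt_two_pow_self.le
    have hnp : (0 : ℝ) < n := by exact_mod_cast hn
    rw [Real.Gamma_add_one (by positivity), mul_pow]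
    have e : z ^ n / Real.Gamma (α * n) = α * (n * z ^ n / (α * n * Real.Gamma (α * n))) := by
      field_simp
    rw [e]
    gcongr

open ProbabilityTheory in
lemma aux_swap (a b : ℝ) (ψ : ℝ → ℝ) (hψc : ContinuousOn ψ (Set.Icc a b))
    (hmono : StrictMonoOn ψ (Set.Icc a b))
    (hψ' : ∀ x ∈ Set.Icc a b, deriv ψ x ≠ 0) (α β : ℝ) (hα : 0 < α) (hβ : 0 < β)
    (T : ℝ) (hT : T ∈ Set.Icc a b) (w : ℝ → ENNReal) (hwt : ∀ x, w x ≠ ⊤)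
    (hw : AEMeasurable w (volume.restrict (Set.Ioo a T))) :
    ∫⁻ σ in Set.Ioo a T, ENNReal.ofReal |deriv ψ σ| * ENNReal.ofReal ((ψ T - ψ σ) ^ (β - 1)) *
      ∫⁻ τ in Set.Ioo a σ, ENNReal.ofReal |deriv ψ τ| *
        ENNReal.ofReal ((ψ σ - ψ τ) ^ (α - 1)) * w τ =
    ENNReal.ofReal (beta α β) * ∫⁻ τ in Set.Ioo a T, ENNReal.ofReal |deriv ψ τ| *
        ENNReal.ofReal ((ψ T - ψ τ) ^ (α + β - 1)) * w τ := by
  have hsub : Set.Ioo a T ⊆ Set.Icc a b := fun x hx => ⟨hx.1.le, hx.2.le.trans hT.2⟩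
  set μ := volume.restrict (Set.Ioo a T) with hμ
  let f : ℝ → ℝ → ENNReal := fun σ τ =>
    ENNReal.ofReal |deriv ψ σ| * ENNReal.ofReal ((ψ T - ψ σ) ^ (β - 1)) *
      (ENNReal.ofReal |deriv ψ τ| * ENNReal.ofReal ((ψ σ - ψ τ) ^ (α - 1)) * w τ)
  let k : ℝ → ℝ → ENNReal := fun σ τ =>
    ({p : ℝ × ℝ | p.2 < p.1} : Set (ℝ × ℝ)).indicator (fun p => f p.1 p.2) (σ, τ)
  have hψm : AEMeasurable ψ μ := (hψc.mono hsub).aemeasurable measurableSet_Ioo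
  have hdm : Measurable (deriv ψ) := measurable_deriv ψ
  have h1 : AEMeasurable (fun p : ℝ × ℝ => ψ p.1) (μ.prod μ) :=
    hψm.comp_quasiMeasurePreserving Measure.quasiMeasurePreserving_fst
  have h2 : AEMeasurable (fun p : ℝ × ℝ => ψ p.2) (μ.prod μ) :=
    hψm.comp_quasiMeasurePreserving Measure.quasiMeasurePreserving_snd
  have h3 : AEMeasurable (fun p : ℝ × ℝ => w p.2) (μ.prod μ) :=
    hw.comp_quasiMeasurePreserving Measure.quasiMeasurePreserving_snd
  have hk : AEMeasurable (Function.uncurry k) (μ.prod μ) := by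
    have : AEMeasurable (fun p : ℝ × ℝ => f p.1 p.2) (μ.prod μ) := by
      simp only [f]
      have d1 : AEMeasurable (fun p : ℝ × ℝ => ENNReal.ofReal |deriv ψ p.1|) (μ.prod μ) := by
        fun_prop
      have d2 : AEMeasurable (fun p : ℝ × ℝ => ENNReal.ofReal |deriv ψ p.2|) (μ.prod μ) := by
        fun_prop
      exact (d1.mul ((h1.const_sub _).pow_const _).ennreal_ofReal).mul
        ((d2.mul ((h1.sub h2).pow_const _).ennreal_ofReal).mul h3)
    exact this.indicator (measurableSet_lt measurable_snd measurable_fst)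
  have hL : ∀ σ ∈ Set.Ioo a T, ∫⁻ τ, k σ τ ∂μ = ENNReal.ofReal |deriv ψ σ| *
      ENNReal.ofReal ((ψ T - ψ σ) ^ (β - 1)) *
      ∫⁻ τ in Set.Ioo a σ, ENNReal.ofReal |deriv ψ τ| *
        ENNReal.ofReal ((ψ σ - ψ τ) ^ (α - 1)) * w τ := by
    intro σ hσ
    have : (fun τ => k σ τ) = (Set.Iio σ).indicator (fun τ => f σ τ) := by
      ext τ; simp only [k, Set.indicator]; rfl
    rw [this, lintegral_indicator measurableSet_Iio, hμ, Measure.restrict_restrict measurableSet_Iio]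
    have : Set.Iio σ ∩ Set.Ioo a T = Set.Ioo a σ := by
      ext x; simp only [Set.mem_inter_iff, Set.mem_Iio, Set.mem_Ioo]
      exact ⟨fun h => ⟨h.2.1, h.1⟩, fun h => ⟨h.2, h.1, h.2.trans hσ.2⟩⟩
    rw [this, lintegral_const_mul' _ _ (by finiteness)]
  have hR : ∀ τ ∈ Set.Ioo a T, ∫⁻ σ, k σ τ ∂μ = ENNReal.ofReal (beta α β) *
      (ENNReal.ofReal |deriv ψ τ| * ENNReal.ofReal ((ψ T - ψ τ) ^ (α + β - 1)) * w τ) := by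
    intro τ hτ
    have : (fun σ => k σ τ) = (Set.Ioi τ).indicator (fun σ => f σ τ) := by
      ext τ; simp only [k, Set.indicator]; rfl
    rw [this, lintegral_indicator measurableSet_Ioi, hμ, Measure.restrict_restrict measurableSet_Ioi]
    have : Set.Ioi τ ∩ Set.Ioo a T = Set.Ioo τ T := by
      ext x; simp only [Set.mem_inter_iff, Set.mem_Ioi, Set.mem_Ioo]
      exact ⟨fun h => ⟨h.1, h.2.2⟩, fun h => ⟨h.1, hτ.1.trans h.1, h.2⟩⟩
    rw [this]
    have e : ∫⁻ σ in Set.Ioo τ T, f σ τ = ∫⁻ σ in Set.Ioo τ T,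
        (ENNReal.ofReal |deriv ψ τ| * w τ) * (ENNReal.ofReal |deriv ψ σ| *
          ENNReal.ofReal ((ψ T - ψ σ) ^ (β - 1) * (ψ σ - ψ τ) ^ (α - 1))) := by
      refine setLIntegral_congr_fun measurableSet_Ioo fun x hx => ?_
      have hx' : x ∈ Set.Icc a b := hsub ⟨hτ.1.trans hx.1, hx.2⟩
      have e2 : 0 < ψ T - ψ x := sub_pos.2 (hmono hx' hT hx.2)
      simp only [f]
      rw [ENNReal.ofReal_mul (by positivity)]
      ring
    have hne : ENNReal.ofReal |deriv ψ τ| * w τ ≠ ⊤ := ENNReal.mul_ne_top (by finiteness) (hwt τ)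
    rw [e, lintegral_const_mul' _ _ hne,
      aux_key a b ψ hψc hmono hψ' α β hα hβ τ T (hsub hτ) hT hτ.2,
      ENNReal.ofReal_mul (beta_pos hα hβ).le]
    ring
  calc _ = ∫⁻ σ, ∫⁻ τ, k σ τ ∂μ ∂μ :=
        (setLIntegral_congr_fun measurableSet_Ioo hL).symm
    _ = ∫⁻ τ, ∫⁻ σ, k σ τ ∂μ ∂μ := lintegral_lintegral_swap hk
    _ = _ := by
        rw [← lintegral_const_mul' _ _ ENNReal.ofReal_ne_top]
        exact setLIntegral_congr_fun measurableSet_Ioo hR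

open ProbabilityTheory in
lemma aux_one (a b : ℝ) (ψ : ℝ → ℝ) (hψc : ContinuousOn ψ (Set.Icc a b))
    (hmono : StrictMonoOn ψ (Set.Icc a b))
    (hψ' : ∀ x ∈ Set.Icc a b, deriv ψ x ≠ 0) (β : ℝ) (hβ : 0 < β)
    (T : ℝ) (hT : T ∈ Set.Icc a b) :
    ∫⁻ σ in Set.Ioo a T, ENNReal.ofReal |deriv ψ σ| * ENNReal.ofReal ((ψ T - ψ σ) ^ (β - 1)) =
    ENNReal.ofReal ((ψ T - ψ a) ^ β / β) := by
  rcases hT.1.eq_or_lt with h | h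
  · subst h
    simp [Real.zero_rpow hβ.ne']
  · have := aux_key a b ψ hψc hmono hψ' 1 β one_pos hβ a T ⟨le_rfl, hT.1.trans hT.2⟩ hT h
    simp only [sub_self, Real.rpow_zero, mul_one, add_sub_cancel_left] at this
    rw [this, beta, Real.Gamma_one, add_comm 1 β, Real.Gamma_add_one hβ.ne']
    have := Real.Gamma_pos_of_pos hβ
    congr 1
    field_simp

lemma aux_step (a b α : ℝ) (u ψ : ℝ → ℝ) (V G : ℝ) (hα : 0 < α) (hψc : ContinuousOn ψ (Set.Icc a b))
    (hmono : StrictMonoOn ψ (Set.Icc a b))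
    (hψ' : ∀ x ∈ Set.Icc a b, deriv ψ x ≠ 0) 
    (T : ℝ) (hT : T ∈ Set.Icc a b) (hV : 0 ≤ V) (hG : 0 ≤ G)
    (hw : AEMeasurable u (volume.restrict (Set.Ioo a T)))
    (hyp : ∀ t ∈ Set.Icc a T, ENNReal.ofReal (u t) ≤ ENNReal.ofReal V + ENNReal.ofReal G *
      ∫⁻ τ in Set.Ioo a t, ENNReal.ofReal |deriv ψ τ| *
        ENNReal.ofReal ((ψ t - ψ τ) ^ (α - 1)) * ENNReal.ofReal (u τ)) (n : ℕ) :
    ENNReal.ofReal (u T) ≤ ENNReal.ofReal (V * ∑ k ∈ Finset.range (n + 1),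
      (G * Real.Gamma α * (ψ T - ψ a) ^ α) ^ k / Real.Gamma (α * k + 1)) +
      ENNReal.ofReal ((G * Real.Gamma α) ^ (n + 1) / Real.Gamma (α * (n + 1 : ℕ))) *
      ∫⁻ τ in Set.Ioo a T, ENNReal.ofReal |deriv ψ τ| *
        ENNReal.ofReal ((ψ T - ψ τ) ^ (α * (n + 1 : ℕ) - 1)) * ENNReal.ofReal (u τ) := by
  have hsub : Set.Ioo a T ⊆ Set.Icc a b := fun x hx => ⟨hx.1.le, hx.2.le.trans hT.2⟩
  have hGα := Real.Gamma_pos_of_pos hα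
  have hL : 0 ≤ ψ T - ψ a :=
    sub_nonneg.2 (hmono.monotoneOn ⟨le_rfl, hT.1.trans hT.2⟩ hT hT.1)
  have hψm : AEMeasurable ψ (volume.restrict (Set.Ioo a T)) :=
    (hψc.mono hsub).aemeasurable measurableSet_Ioo
  have hdm : Measurable (deriv ψ) := measurable_deriv ψ
  induction n with
  | zero =>
    have := hyp T ⟨hT.1, le_rfl⟩
    simpa [hGα.ne'] using this
  | succ n ih =>
    set β : ℝ := α * (n + 1 : ℕ) with hβ
    have hβ0 : 0 < β := by positivity
    have hGβ := Real.Gamma_pos_of_pos hβ0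
    have hGab := Real.Gamma_pos_of_pos (add_pos hα hβ0)
    have hG1 := Real.Gamma_pos_of_pos (s := β + 1) (by positivity)
    have eβ : α * (n + 1 + 1 : ℕ) = α + β := by rw [hβ]; push_cast; ring
    refine ih.trans ?_
    have hb : ∫⁻ τ in Set.Ioo a T, ENNReal.ofReal |deriv ψ τ| *
        ENNReal.ofReal ((ψ T - ψ τ) ^ (β - 1)) * ENNReal.ofReal (u τ) ≤
        ENNReal.ofReal V * ENNReal.ofReal ((ψ T - ψ a) ^ β / β) +
        ENNReal.ofReal G * (ENNReal.ofReal (ProbabilityTheory.beta α β) *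
        ∫⁻ τ in Set.Ioo a T, ENNReal.ofReal |deriv ψ τ| *
        ENNReal.ofReal ((ψ T - ψ τ) ^ (α + β - 1)) * ENNReal.ofReal (u τ)) := by
      rw [← aux_swap a b ψ hψc hmono hψ' α β hα hβ0 T hT _ (fun x => ENNReal.ofReal_ne_top)
        hw.ennreal_ofReal, ← aux_one a b ψ hψc hmono hψ' β hβ0 T hT,
        ← lintegral_const_mul' _ _ ENNReal.ofReal_ne_top,
        ← lintegral_const_mul' _ _ ENNReal.ofReal_ne_top, ← lintegral_add_left']
      · refine setLIntegral_mono' measurableSet_Ioo fun x hx => ?_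
        refine (mul_le_mul_right (hyp x ⟨hx.1.le, hx.2.le⟩) _).trans_eq ?_
        ring
      · have d1 : AEMeasurable (fun p : ℝ => ENNReal.ofReal |deriv ψ p|)
          (volume.restrict (Set.Ioo a T)) := by fun_prop
        exact (d1.mul ((hψm.const_sub _).pow_const _).ennreal_ofReal).const_mul _
    refine (add_le_add_right (mul_le_mul_right hb _) _).trans_eq ?_
    rw [eβ, Finset.sum_range_succ _ (n + 1), mul_add V]
    rw [ENNReal.ofReal_add, mul_add, add_assoc]
    · congr 1
      congr 1
      · rw [← ENNReal.ofReal_mul hV, ← ENNReal.ofReal_mul (by positivity)]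
        congr 1
        rw [← hβ, Real.Gamma_add_one hβ0.ne', mul_pow _ ((ψ T - ψ a) ^ α), ← Real.rpow_natCast
          ((ψ T - ψ a) ^ α), ← Real.rpow_mul hL, ← hβ]
        field_simp
      · rw [← mul_assoc, ← mul_assoc, ← ENNReal.ofReal_mul (by positivity),
          ← ENNReal.ofReal_mul (by positivity)]
        congr 2
        rw [ProbabilityTheory.beta, pow_succ _ (n + 1)]
        field_simp
    · refine mul_nonneg hV (Finset.sum_nonneg fun k _ => ?_)
      have := Real.Gamma_pos_of_pos (s := α * k + 1) (by positivity)
      positivity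
    · rw [← hβ]
      positivity

theorem stmt8 (a b α : ℝ) (u v g ψ : ℝ → ℝ) (hab : a < b) (hα : 0 < α)
    (hu : IntervalIntegrable u volume a b) (hv : IntervalIntegrable v volume a b)
    (hg : ContinuousOn g (Set.Icc a b))
    (hu0 : ∀ t ∈ Set.Icc a b, 0 ≤ u t) (hv0 : ∀ t ∈ Set.Icc a b, 0 ≤ v t)
    (hg0 : ∀ t ∈ Set.Icc a b, 0 ≤ g t) (hgmono : MonotoneOn g (Set.Icc a b))
    (hvmono : MonotoneOn v (Set.Icc a b))
    (hψ : ContDiffOn ℝ 1 ψ (Set.Icc a b)) (hmono : StrictMonoOn ψ (Set.Icc a b))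
    (hψ' : ∀ x ∈ Set.Icc a b, deriv ψ x ≠ 0)
    (hyp : ∀ t ∈ Set.Icc a b,
      u t ≤ v t + g t * ∫ τ in a..t, deriv ψ τ * (ψ t - ψ τ) ^ (α - 1) * u τ) :
    ∀ t ∈ Set.Icc a b,
      u t ≤ v t * mittagLeffler α (g t * Real.Gamma α * (ψ t - ψ a) ^ α) := by
  intro T hT
  have hψc : ContinuousOn ψ (Set.Icc a b) := hψ.continuousOn
  have ha : a ∈ Set.Icc a b := ⟨le_rfl, hab.le⟩
  have hV := hv0 T hT
  have hG := hg0 T hT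
  have hGα := Real.Gamma_pos_of_pos hα
  have hL : 0 ≤ ψ T - ψ a := sub_nonneg.2 (hmono.monotoneOn ha hT hT.1)
  have hsub : Set.Ioo a T ⊆ Set.Icc a b := fun x hx => ⟨hx.1.le, hx.2.le.trans hT.2⟩
  have huI : IntegrableOn u (Set.Ioo a T) := by
    rw [intervalIntegrable_iff_integrableOn_Ioc_of_le hab.le] at hu
    exact hu.mono_set fun x hx => ⟨hx.1, hx.2.le.trans hT.2⟩
  have hyp' : ∀ t ∈ Set.Icc a T, ENNReal.ofReal (u t) ≤ ENNReal.ofReal (v T) +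
      ENNReal.ofReal (g T) *
      ∫⁻ τ in Set.Ioo a t, ENNReal.ofReal |deriv ψ τ| *
        ENNReal.ofReal ((ψ t - ψ τ) ^ (α - 1)) * ENNReal.ofReal (u τ) := by
    intro t ht
    have ht' : t ∈ Set.Icc a b := ⟨ht.1, ht.2.trans hT.2⟩
    have h1 := hyp t ht'
    rw [intervalIntegral.integral_of_le ht.1, integral_Ioc_eq_integral_Ioo] at h1
    set I := ∫ τ in Set.Ioo a t, deriv ψ τ * (ψ t - ψ τ) ^ (α - 1) * u τ with hI
    have h2 : ENNReal.ofReal |I| ≤ ∫⁻ τ in Set.Ioo a t, ENNReal.ofReal |deriv ψ τ| *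
        ENNReal.ofReal ((ψ t - ψ τ) ^ (α - 1)) * ENNReal.ofReal (u τ) := by
      rw [← Real.norm_eq_abs, ofReal_norm, hI]
      refine (enorm_integral_le_lintegral_enorm _).trans_eq ?_
      refine setLIntegral_congr_fun measurableSet_Ioo fun x hx => ?_
      have hx' : x ∈ Set.Icc a b := ⟨hx.1.le, hx.2.le.trans ht'.2⟩
      have e2 : 0 < ψ t - ψ x := sub_pos.2 (hmono hx' ht' hx.2)
      have e3 := hu0 x hx'
      rw [← ofReal_norm, Real.norm_eq_abs, abs_mul, abs_mul, abs_of_nonneg e3,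
        abs_of_nonneg (a := (ψ t - ψ x) ^ (α - 1)) (by positivity),
        ENNReal.ofReal_mul (by positivity), ENNReal.ofReal_mul (by positivity)]
    have h3 : u t ≤ v T + g T * |I| := by
      have q1 := hvmono ht' hT ht.2
      have q2 := hgmono ht' hT ht.2
      have q3 := hg0 t ht'
      have q4 : g t * I ≤ g T * |I| :=
        (mul_le_mul_of_nonneg_left (le_abs_self I) q3).trans
          (mul_le_mul_of_nonneg_right q2 (abs_nonneg I))
      linarith
    refine (ENNReal.ofReal_le_ofReal h3).trans ?_
    rw [ENNReal.ofReal_add hV (by positivity), ENNReal.ofReal_mul hG]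
    gcongr
  have hstep := aux_step a b α u ψ (v T) (g T) hα hψc hmono hψ' T hT hV hG
    huI.aemeasurable hyp'
  obtain ⟨K, hK⟩ := isCompact_Icc.exists_bound_of_continuousOn
    (hψ.continuousOn_derivWithin (uniqueDiffOn_Icc hab) le_rfl)
  set C := ∫⁻ τ in Set.Ioo a T, ENNReal.ofReal |deriv ψ τ| * ENNReal.ofReal (u τ) with hC
  have hCtop : C ≠ ⊤ := by
    have hle : C ≤ ∫⁻ τ in Set.Ioo a T, ENNReal.ofReal K * ENNReal.ofReal (u τ) := by
      refine setLIntegral_mono' measurableSet_Ioo fun x hx => ?_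
      have hK' := hK x (hsub hx)
      rw [derivWithin_of_mem_nhds (Icc_mem_nhds hx.1 (hx.2.trans_le hT.2)),
        Real.norm_eq_abs] at hK'
      gcongr
    refine ne_top_of_le_ne_top ?_ hle
    rw [lintegral_const_mul' _ _ ENNReal.ofReal_ne_top]
    refine ENNReal.mul_ne_top ENNReal.ofReal_ne_top ?_
    exact huI.lintegral_lt_top.ne
  set M := max (ψ T - ψ a) 1 with hM
  have hM1 : 1 ≤ M := le_max_right _ _
  have hM0 : 0 < M := by linarith
  set z := g T * Real.Gamma α * (ψ T - ψ a) ^ α with hz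
  have hz0 : 0 ≤ z := by positivity
  have hsum := aux_summable α z hα hz0
  set y := g T * Real.Gamma α * M ^ α with hy
  have hy0 : 0 ≤ y := by positivity
  have hlim : Filter.Tendsto (fun n : ℕ => v T * mittagLeffler α z +
      y ^ (n + 1) / Real.Gamma (α * (n + 1 : ℕ)) * C.toReal) Filter.atTop
      (nhds (v T * mittagLeffler α z)) := by
    have := ((aux_tendsto α y hα hy0).comp (Filter.tendsto_add_atTop_nat 1)).mul_const C.toReal
    have := this.const_add (v T * mittagLeffler α z)
    simpa using this
  refine ge_of_tendsto hlim ?_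
  have hev : ∀ᶠ n : ℕ in Filter.atTop, 1 ≤ α * (n + 1 : ℕ) := by
    obtain ⟨N, hN⟩ := exists_nat_gt (1 / α)
    filter_upwards [Filter.eventually_ge_atTop N] with n hn
    rw [div_lt_iff₀ hα] at hN
    have : (N : ℝ) ≤ n := by exact_mod_cast hn
    push_cast
    nlinarith
  filter_upwards [hev] with n hn
  have hΓ := Real.Gamma_pos_of_pos (s := α * (n + 1 : ℕ)) (by linarith)
  have hF : ∫⁻ τ in Set.Ioo a T, ENNReal.ofReal |deriv ψ τ| *
        ENNReal.ofReal ((ψ T - ψ τ) ^ (α * (n + 1 : ℕ) - 1)) * ENNReal.ofReal (u τ) ≤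
        ENNReal.ofReal (M ^ (α * (n + 1 : ℕ))) * C := by
    rw [hC, ← lintegral_const_mul' _ _ ENNReal.ofReal_ne_top]
    refine setLIntegral_mono' measurableSet_Ioo fun x hx => ?_
    have e2 : 0 < ψ T - ψ x := sub_pos.2 (hmono (hsub hx) hT hx.2)
    have e3 : ψ T - ψ x ≤ M := by
      have := hmono ha (hsub hx) hx.1
      have : ψ T - ψ a ≤ M := le_max_left _ _
      linarith
    have e4 : (ψ T - ψ x) ^ (α * (n + 1 : ℕ) - 1) ≤ M ^ (α * (n + 1 : ℕ)) :=
      (Real.rpow_le_rpow e2.le e3 (by linarith)).trans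
        (Real.rpow_le_rpow_of_exponent_le hM1 (by linarith))
    rw [mul_comm (ENNReal.ofReal |deriv ψ x|), mul_assoc]
    gcongr
  have hS : ∑ k ∈ Finset.range (n + 1), z ^ k / Real.Gamma (α * k + 1) ≤ mittagLeffler α z := by
    refine hsum.sum_le_tsum _ fun k _ => ?_
    have := Real.Gamma_pos_of_pos (s := α * k + 1) (by positivity)
    positivity
  have hE0 : 0 ≤ mittagLeffler α z := by
    refine tsum_nonneg fun k => ?_
    have := Real.Gamma_pos_of_pos (s := α * k + 1) (by positivity)
    positivity
  have hfin := (hstep n).trans (add_le_add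
    (ENNReal.ofReal_le_ofReal (mul_le_mul_of_nonneg_left hS hV)) (mul_le_mul_right hF _))
  rw [← ENNReal.ofReal_toReal hCtop, ← ENNReal.ofReal_mul (by positivity),
    ← ENNReal.ofReal_mul (by positivity), ← ENNReal.ofReal_add (by positivity) (by positivity),
    ENNReal.ofReal_le_ofReal_iff (by positivity)] at hfin
  refine hfin.trans_eq ?_
  congr 1
  rw [hy, mul_pow _ (M ^ α), ← Real.rpow_natCast (M ^ α), ← Real.rpow_mul hM0.le]
  ring
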